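/- Uniqueness of constrained-inferred types in the cumulative bidirectional system: if ⊢ Γ and either Γ ⊢ t ▹_□ T and Γ ⊢ t ▹_□ T', or Γ ⊢ t ▹_Π T and Γ ⊢ t ▹_Π T', then T ≡ T'. -/

import Mathlib

/-! Formalization of CCω (terms, reduction, conversion, undirected and
bidirectional typing, cumulativity) using de Bruijn indices, following
Lennon-Bertrand, "Complete Bidirectional Typing for the Calculus of
Inductive Constructions". -/

namespace CComega

/-- Terms of CCω: `t ::= x | □_i | Πx:t.t | λx:t.t | t t`,
with variables as de Bruijn indices. -/
inductive Tm : Type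
  | var : ℕ → Tm
  | sort : ℕ → Tm
  | pi : Tm → Tm → Tm
  | lam : Tm → Tm → Tm
  | app : Tm → Tm → Tm
deriving DecidableEq

/-- `lift n k t` shifts by `n` the de Bruijn indices of `t` that are ≥ `k`. -/
def lift (n k : ℕ) : Tm → Tm
  | .var i => if i < k then .var i else .var (i + n)
  | .sort i => .sort i
  | .pi A B => .pi (lift n k A) (lift n (k + 1) B)
  | .lam A t => .lam (lift n k A) (lift n (k + 1) t)
  | .app t u => .app (lift n k t) (lift n k u)

/-- `subst u k t` is the capture-avoiding substitution `t[u/k]` of `u`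
for de Bruijn index `k` in `t`. -/
def subst (u : Tm) (k : ℕ) : Tm → Tm
  | .var i => if i < k then .var i else if i = k then lift k 0 u else .var (i - 1)
  | .sort i => .sort i
  | .pi A B => .pi (subst u k A) (subst u (k + 1) B)
  | .lam A t => .lam (subst u k A) (subst u (k + 1) t)
  | .app t v => .app (subst u k t) (subst u k v)

/-- One-step reduction `t → t'`: the least congruence such that
`(λx:A.t) u → t[u/x]`. -/
inductive Red : Tm → Tm → Prop
  | beta (A t u : Tm) : Red (.app (.lam A t) u) (subst u 0 t)
  | piDom {A A'} (B : Tm) : Red A A' → Red (.pi A B) (.pi A' B)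
  | piCod (A : Tm) {B B'} : Red B B' → Red (.pi A B) (.pi A B')
  | lamDom {A A'} (t : Tm) : Red A A' → Red (.lam A t) (.lam A' t)
  | lamBody (A : Tm) {t t'} : Red t t' → Red (.lam A t) (.lam A t')
  | appFun {t t'} (u : Tm) : Red t t' → Red (.app t u) (.app t' u)
  | appArg (t : Tm) {u u'} : Red u u' → Red (.app t u) (.app t u')

/-- Multi-step reduction `t ↠ t'`: reflexive-transitive closure of `→`. -/
def Reds : Tm → Tm → Prop := Relation.ReflTransGen Red

/-- Conversion `t ≡ u`: symmetric, reflexive, transitive closure of `→`. -/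
def Conv : Tm → Tm → Prop := Relation.EqvGen Red

/-- Contexts are lists of (de Bruijn) declarations, most recent first. -/
abbrev Ctx := List Tm

mutual
/-- Context well-formedness `⊢ Γ`. -/
inductive WfCtx : Ctx → Prop
  | nil : WfCtx []
  | cons {Γ A i} : WfCtx Γ → Typed Γ A (.sort i) → WfCtx (A :: Γ)

/-- Undirected typing `Γ ⊢ t : T`. -/
inductive Typed : Ctx → Tm → Tm → Prop
  | sort {Γ i} : WfCtx Γ → Typed Γ (.sort i) (.sort (i + 1))
  | var {Γ n A} : WfCtx Γ → Γ[n]? = some A → Typed Γ (.var n) (lift (n + 1) 0 A)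
  | pi {Γ A B i j} : Typed Γ A (.sort i) → Typed (A :: Γ) B (.sort j) →
      Typed Γ (.pi A B) (.sort (max i j))
  | lam {Γ A B t i} : Typed Γ (.pi A B) (.sort i) → Typed (A :: Γ) t B →
      Typed Γ (.lam A t) (.pi A B)
  | app {Γ t u A B} : Typed Γ t (.pi A B) → Typed Γ u A →
      Typed Γ (.app t u) (subst u 0 B)
  | conv {Γ t A B i} : Typed Γ t A → Typed Γ B (.sort i) → Conv A B →
      Typed Γ t B
end

mutual
/-- Bidirectional inference `Γ ⊢ t ▹ T`. -/
inductive Infer : Ctx → Tm → Tm → Prop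
  | sort {Γ i} : Infer Γ (.sort i) (.sort (i + 1))
  | var {Γ n A} : Γ[n]? = some A → Infer Γ (.var n) (lift (n + 1) 0 A)
  | pi {Γ A B i j} : InferSort Γ A (.sort i) → InferSort (A :: Γ) B (.sort j) →
      Infer Γ (.pi A B) (.sort (max i j))
  | lam {Γ A t B i} : InferSort Γ A (.sort i) → Infer (A :: Γ) t B →
      Infer Γ (.lam A t) (.pi A B)
  | app {Γ t u A B} : InferPi Γ t (.pi A B) → Check Γ u A →
      Infer Γ (.app t u) (subst u 0 B)

/-- Bidirectional checking `Γ ⊢ t ◃ T`. -/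
inductive Check : Ctx → Tm → Tm → Prop
  | check {Γ t T T'} : Infer Γ t T' → Conv T' T → Check Γ t T

/-- Constrained inference `Γ ⊢ t ▹_□ T` (the output is a universe). -/
inductive InferSort : Ctx → Tm → Tm → Prop
  | inferSort {Γ t T i} : Infer Γ t T → Reds T (.sort i) → InferSort Γ t (.sort i)

/-- Constrained inference `Γ ⊢ t ▹_Π T` (the output is a product type). -/
inductive InferPi : Ctx → Tm → Tm → Prop
  | inferPi {Γ t T A B} : Infer Γ t T → Reds T (.pi A B) → InferPi Γ t (.pi A B)
end

/-- Weak-head reduction `t ⇝ t'`: reduction only at the head. -/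
inductive WhRed : Tm → Tm → Prop
  | beta (A t u : Tm) : WhRed (.app (.lam A t) u) (subst u 0 t)
  | appFun {t t'} (u : Tm) : WhRed t t' → WhRed (.app t u) (.app t' u)

/-- Multi-step weak-head reduction `t ⇝* t'`. -/
def WhReds : Tm → Tm → Prop := Relation.ReflTransGen WhRed

mutual
/-- Weak-head bidirectional inference: as `Infer`, but constrained inference
uses weak-head reduction. -/
inductive InferW : Ctx → Tm → Tm → Prop
  | sort {Γ i} : InferW Γ (.sort i) (.sort (i + 1))
  | var {Γ n A} : Γ[n]? = some A → InferW Γ (.var n) (lift (n + 1) 0 A)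
  | pi {Γ A B i j} : InferSortW Γ A (.sort i) → InferSortW (A :: Γ) B (.sort j) →
      InferW Γ (.pi A B) (.sort (max i j))
  | lam {Γ A t B i} : InferSortW Γ A (.sort i) → InferW (A :: Γ) t B →
      InferW Γ (.lam A t) (.pi A B)
  | app {Γ t u A B} : InferPiW Γ t (.pi A B) → CheckW Γ u A →
      InferW Γ (.app t u) (subst u 0 B)

/-- Weak-head bidirectional checking. -/
inductive CheckW : Ctx → Tm → Tm → Prop
  | check {Γ t T T'} : InferW Γ t T' → Conv T' T → CheckW Γ t T

/-- Weak-head constrained inference `Γ ⊢ t ▹_□ T`. -/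
inductive InferSortW : Ctx → Tm → Tm → Prop
  | inferSort {Γ t T i} : InferW Γ t T → WhReds T (.sort i) →
      InferSortW Γ t (.sort i)

/-- Weak-head constrained inference `Γ ⊢ t ▹_Π T`. -/
inductive InferPiW : Ctx → Tm → Tm → Prop
  | inferPi {Γ t T A B} : InferW Γ t T → WhReds T (.pi A B) →
      InferPiW Γ t (.pi A B)
end

/-- Cumulativity `t ≼ u`: the least transitive relation containing conversion
such that `□_i ≼ □_j` whenever `i ≤ j` and `Πx:A.B ≼ Πx:A'.B'` whenever
`A ≡ A'` and `B ≼ B'`. -/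
inductive Cum : Tm → Tm → Prop
  | ofConv {t u} : Conv t u → Cum t u
  | sort {i j : ℕ} : i ≤ j → Cum (.sort i) (.sort j)
  | pi {A A' B B'} : Conv A A' → Cum B B' → Cum (.pi A B) (.pi A' B')
  | trans {t u v} : Cum t u → Cum u v → Cum t v

mutual
/-- Context well-formedness for the cumulative undirected system. -/
inductive WfCtxC : Ctx → Prop
  | nil : WfCtxC []
  | cons {Γ A i} : WfCtxC Γ → TypedC Γ A (.sort i) → WfCtxC (A :: Γ)

/-- Cumulative undirected typing `Γ ⊢ t : T`: as `Typed`, with the conversion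
rule replaced by cumulativity. -/
inductive TypedC : Ctx → Tm → Tm → Prop
  | sort {Γ i} : WfCtxC Γ → TypedC Γ (.sort i) (.sort (i + 1))
  | var {Γ n A} : WfCtxC Γ → Γ[n]? = some A → TypedC Γ (.var n) (lift (n + 1) 0 A)
  | pi {Γ A B i j} : TypedC Γ A (.sort i) → TypedC (A :: Γ) B (.sort j) →
      TypedC Γ (.pi A B) (.sort (max i j))
  | lam {Γ A B t i} : TypedC Γ (.pi A B) (.sort i) → TypedC (A :: Γ) t B →
      TypedC Γ (.lam A t) (.pi A B)
  | app {Γ t u A B} : TypedC Γ t (.pi A B) → TypedC Γ u A →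
      TypedC Γ (.app t u) (subst u 0 B)
  | cumul {Γ t A B i} : TypedC Γ t A → TypedC Γ B (.sort i) → Cum A B →
      TypedC Γ t B
end

mutual
/-- Cumulative bidirectional inference `Γ ⊢ t ▹ T`. -/
inductive InferC : Ctx → Tm → Tm → Prop
  | sort {Γ i} : InferC Γ (.sort i) (.sort (i + 1))
  | var {Γ n A} : Γ[n]? = some A → InferC Γ (.var n) (lift (n + 1) 0 A)
  | pi {Γ A B i j} : InferSortC Γ A (.sort i) → InferSortC (A :: Γ) B (.sort j) →
      InferC Γ (.pi A B) (.sort (max i j))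
  | lam {Γ A t B i} : InferSortC Γ A (.sort i) → InferC (A :: Γ) t B →
      InferC Γ (.lam A t) (.pi A B)
  | app {Γ t u A B} : InferPiC Γ t (.pi A B) → CheckC Γ u A →
      InferC Γ (.app t u) (subst u 0 B)

/-- Cumulative bidirectional checking `Γ ⊢ t ◃ T`, using cumulativity. -/
inductive CheckC : Ctx → Tm → Tm → Prop
  | check {Γ t T T'} : InferC Γ t T' → Cum T' T → CheckC Γ t T

/-- Cumulative constrained inference `Γ ⊢ t ▹_□ T` (unchanged: uses reduction). -/
inductive InferSortC : Ctx → Tm → Tm → Prop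
  | inferSort {Γ t T i} : InferC Γ t T → Reds T (.sort i) → InferSortC Γ t (.sort i)

/-- Cumulative constrained inference `Γ ⊢ t ▹_Π T` (unchanged: uses reduction). -/
inductive InferPiC : Ctx → Tm → Tm → Prop
  | inferPi {Γ t T A B} : InferC Γ t T → Reds T (.pi A B) → InferPiC Γ t (.pi A B)
end

theorem lift_lift_of_le (m n : ℕ) (t : Tm) {i j : ℕ} (h₁ : j ≤ i) (h₂ : i ≤ j + n) :
    lift m i (lift n j t) = lift (m + n) j t := by
  induction t generalizing i j with
  | var x => grind [lift]
  | sort => rfl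
  | pi A B ihA ihB | lam A B ihA ihB =>
    simp only [lift, ihA h₁ h₂, ihB (Nat.succ_le_succ h₁) (show i + 1 ≤ j + 1 + n by omega)]
  | app t u iht ihu => simp only [lift, iht h₁ h₂, ihu h₁ h₂]

theorem lift_lift_comm (m n : ℕ) (t : Tm) {i j : ℕ} (h : j ≤ i) :
    lift m (i + n) (lift n j t) = lift n j (lift m i t) := by
  induction t generalizing i j with
  | var x => grind [lift]
  | sort => rfl
  | pi A B ihA ihB | lam A B ihA ihB =>
    simp only [lift, ihA h, Nat.add_right_comm i n 1, ihB (Nat.succ_le_succ h)]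
  | app t u iht ihu => simp only [lift, iht h, ihu h]

theorem lift_subst (m i k : ℕ) (u t : Tm) :
    lift m (k + i) (subst u k t) = subst (lift m i u) k (lift m (k + i + 1) t) := by
  induction t generalizing k with
  | var x =>
    have h := lift_lift_comm m k u (Nat.zero_le i)
    grind [lift, subst]
  | sort => rfl
  | pi A B ihA ihB | lam A B ihA ihB =>
    simp only [lift, subst, ihA, Nat.add_right_comm k i 1, ihB]
  | app t u iht ihu => simp only [lift, subst, iht, ihu]

theorem subst_lift_cancel (u : Tm) (n : ℕ) (t : Tm) {i k : ℕ} (h₁ : k ≤ i) (h₂ : i ≤ k + n) :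
    subst u i (lift (n + 1) k t) = lift n k t := by
  induction t generalizing i k with
  | var x => grind [lift, subst]
  | sort => rfl
  | pi A B ihA ihB | lam A B ihA ihB =>
    simp only [lift, subst, ihA h₁ h₂,
      ihB (Nat.succ_le_succ h₁) (show i + 1 ≤ k + 1 + n by omega)]
  | app t u iht ihu => simp only [lift, subst, iht h₁ h₂, ihu h₁ h₂]

theorem subst_lift_comm (u : Tm) (n : ℕ) (t : Tm) {j k : ℕ} (h : j ≤ k) :
    subst u (k + n) (lift n j t) = lift n j (subst u k t) := by
  induction t generalizing j k with
  | var x =>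
    have h' := lift_lift_of_le n k u (Nat.zero_le j) (show j ≤ 0 + k by omega)
    grind [lift, subst]
  | sort => rfl
  | pi A B ihA ihB | lam A B ihA ihB =>
    simp only [lift, subst, ihA h, Nat.add_right_comm k n 1, ihB (Nat.succ_le_succ h)]
  | app t u iht ihu => simp only [lift, subst, iht h, ihu h]

theorem subst_subst (v u : Tm) (i k : ℕ) (t : Tm) :
    subst v (k + i) (subst u k t) = subst (subst v i u) k (subst v (k + i + 1) t) := by
  induction t generalizing k with
  | var x =>
    have h₁ := subst_lift_comm v k u (Nat.zero_le i)
    have h₂ := subst_lift_cancel (subst v i u) (k + i) v (Nat.zero_le k)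
      (show k ≤ 0 + (k + i) by omega)
    grind [subst]
  | sort => rfl
  | pi A B ihA ihB | lam A B ihA ihB =>
    simp only [subst, ihA, Nat.add_right_comm k i 1, ihB]
  | app t u iht ihu => simp only [subst, iht, ihu]

/-- Parallel reduction. -/
inductive Par : Tm → Tm → Prop
  | var (i : ℕ) : Par (.var i) (.var i)
  | sort (i : ℕ) : Par (.sort i) (.sort i)
  | pi {A A' B B'} : Par A A' → Par B B' → Par (.pi A B) (.pi A' B')
  | lam {A A' t t'} : Par A A' → Par t t' → Par (.lam A t) (.lam A' t')
  | app {t t' u u'} : Par t t' → Par u u' → Par (.app t u) (.app t' u')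
  | beta (A : Tm) {t t' u u'} : Par t t' → Par u u' →
      Par (.app (.lam A t) u) (subst u' 0 t')

theorem Par.refl : ∀ t, Par t t
  | .var i => .var i
  | .sort i => .sort i
  | .pi A B => .pi (refl A) (refl B)
  | .lam A t => .lam (refl A) (refl t)
  | .app t u => .app (refl t) (refl u)

theorem Red.par {t t' : Tm} (h : Red t t') : Par t t' := by
  induction h with
  | beta A t u => exact .beta A (.refl t) (.refl u)
  | piDom B _ ih => exact .pi ih (.refl B)
  | piCod A _ ih => exact .pi (.refl A) ih
  | lamDom t _ ih => exact .lam ih (.refl t)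
  | lamBody A _ ih => exact .lam (.refl A) ih
  | appFun u _ ih => exact .app ih (.refl u)
  | appArg t _ ih => exact .app (.refl t) ih

theorem Par.lift {t t' : Tm} (h : Par t t') (n k : ℕ) :
    Par (CComega.lift n k t) (CComega.lift n k t') := by
  induction h generalizing k with
  | var | sort => exact .refl _
  | pi _ _ ih₁ ih₂ => exact .pi (ih₁ k) (ih₂ (k + 1))
  | lam _ _ ih₁ ih₂ => exact .lam (ih₁ k) (ih₂ (k + 1))
  | app _ _ ih₁ ih₂ => exact .app (ih₁ k) (ih₂ k)
  | @beta A t t' u u' _ _ ih₁ ih₂ =>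
    have h := lift_subst n k 0 u' t'
    simp only [Nat.zero_add] at h
    rw [h]
    exact .beta _ (ih₁ (k + 1)) (ih₂ k)

theorem Par.subst {t t' u u' : Tm} (h : Par t t') (hu : Par u u') (k : ℕ) :
    Par (CComega.subst u k t) (CComega.subst u' k t') := by
  induction h generalizing k with
  | var i =>
    simp only [CComega.subst]
    split_ifs
    exacts [.refl _, hu.lift k 0, .refl _]
  | sort => exact .refl _
  | pi _ _ ih₁ ih₂ => exact .pi (ih₁ k) (ih₂ (k + 1))
  | lam _ _ ih₁ ih₂ => exact .lam (ih₁ k) (ih₂ (k + 1))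
  | app _ _ ih₁ ih₂ => exact .app (ih₁ k) (ih₂ k)
  | @beta A t t' v v' _ _ ih₁ ih₂ =>
    have h := subst_subst u' v' k 0 t'
    simp only [Nat.zero_add] at h
    rw [h]
    exact .beta _ (ih₁ (k + 1)) (ih₂ k)

/-- Complete development: contracts all redexes of a term simultaneously. -/
def develop : Tm → Tm
  | .var i => .var i
  | .sort i => .sort i
  | .pi A B => .pi (develop A) (develop B)
  | .lam A t => .lam (develop A) (develop t)
  | .app (.lam _ t) u => subst (develop u) 0 (develop t)
  | .app t u => .app (develop t) (develop u)

theorem Par.develop {t t' : Tm} (h : Par t t') : Par t' (CComega.develop t) := by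
  induction h with
  | var | sort => exact .refl _
  | pi _ _ ih₁ ih₂ => exact .pi ih₁ ih₂
  | lam _ _ ih₁ ih₂ => exact .lam ih₁ ih₂
  | @app t t' u u' ht _ ih₁ ih₂ =>
    cases ht with
    | lam =>
      cases ih₁ with
      | lam _ ih => exact .beta _ ih ih₂
    | _ => exact .app ih₁ ih₂
  | beta A _ _ ih₁ ih₂ => exact ih₁.subst ih₂ 0

theorem Conv.refl (t : Tm) : Conv t t := Relation.EqvGen.refl t

theorem Conv.symm {t u : Tm} (h : Conv t u) : Conv u t := Relation.EqvGen.symm _ _ h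

theorem Conv.trans {t u v : Tm} (h₁ : Conv t u) (h₂ : Conv u v) : Conv t v :=
  Relation.EqvGen.trans _ _ _ h₁ h₂

theorem Conv.map {f : Tm → Tm} (hf : ∀ {t u}, Red t u → Conv (f t) (f u)) {t u : Tm}
    (h : Conv t u) : Conv (f t) (f u) := by
  induction h with
  | rel _ _ h => exact hf h
  | refl => exact .refl _
  | symm _ _ _ ih => exact ih.symm
  | trans _ _ _ _ _ ih₁ ih₂ => exact ih₁.trans ih₂

theorem Red.conv {t u : Tm} (h : Red t u) : Conv t u := .rel _ _ h

theorem Reds.conv {t u : Tm} (h : Reds t u) : Conv t u := by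
  induction h with
  | refl => exact .refl _
  | tail _ h ih => exact ih.trans h.conv

theorem Conv.pi {A A' B B' : Tm} (hA : Conv A A') (hB : Conv B B') :
    Conv (.pi A B) (.pi A' B') :=
  (hA.map (f := (.pi · B)) fun h => (Red.piDom B h).conv).trans
    (hB.map fun h => (Red.piCod A' h).conv)

theorem Conv.lam {A A' t t' : Tm} (hA : Conv A A') (ht : Conv t t') :
    Conv (.lam A t) (.lam A' t') :=
  (hA.map (f := (.lam · t)) fun h => (Red.lamDom t h).conv).trans
    (ht.map fun h => (Red.lamBody A' h).conv)

theorem Conv.app {t t' u u' : Tm} (ht : Conv t t') (hu : Conv u u') :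
    Conv (.app t u) (.app t' u') :=
  (ht.map (f := (.app · u)) fun h => (Red.appFun u h).conv).trans
    (hu.map fun h => (Red.appArg t' h).conv)

theorem Par.conv {t t' : Tm} (h : Par t t') : Conv t t' := by
  induction h with
  | var | sort => exact .refl _
  | pi _ _ ih₁ ih₂ => exact .pi ih₁ ih₂
  | lam _ _ ih₁ ih₂ => exact .lam ih₁ ih₂
  | app _ _ ih₁ ih₂ => exact .app ih₁ ih₂
  | beta A _ _ ih₁ ih₂ => exact (Conv.app (.lam (.refl A) ih₁) ih₂).trans (Red.beta A _ _).conv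

theorem Conv.subst {t t' : Tm} (h : Conv t t') (u : Tm) (k : ℕ) :
    Conv (CComega.subst u k t) (CComega.subst u k t') :=
  h.map fun h => (h.par.subst (.refl u) k).conv

/-- Church–Rosser: convertible terms have a common parallel reduct. -/
theorem Conv.join {t u : Tm} (h : Conv t u) : Relation.Join (Relation.ReflTransGen Par) t u := by
  have equiv : Equivalence (Relation.Join (Relation.ReflTransGen Par)) :=
    Relation.equivalence_join_reflTransGen fun a _ _ hb hc =>
      ⟨develop a, .single hb.develop, .single hc.develop⟩
  induction h with
  | rel _ u h => exact ⟨u, .single h.par, .refl⟩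
  | refl t => exact equiv.refl t
  | symm _ _ _ ih => exact equiv.symm ih
  | trans _ _ _ _ _ ih₁ ih₂ => exact equiv.trans ih₁ ih₂

theorem reflTransGen_par_sort {i : ℕ} {t : Tm} (h : Relation.ReflTransGen Par (.sort i) t) :
    t = .sort i := by
  induction h with
  | refl => rfl
  | tail _ h ih => subst ih; cases h; rfl

theorem reflTransGen_par_pi {A B t : Tm} (h : Relation.ReflTransGen Par (.pi A B) t) :
    ∃ A' B', t = .pi A' B' ∧ Conv A A' ∧ Conv B B' := by
  induction h with
  | refl => exact ⟨A, B, rfl, .refl A, .refl B⟩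
  | tail _ h ih =>
    obtain ⟨A', B', rfl, hA, hB⟩ := ih
    cases h with
    | pi h₁ h₂ => exact ⟨_, _, rfl, hA.trans h₁.conv, hB.trans h₂.conv⟩

theorem Conv.sort_inj {i j : ℕ} (h : Conv (.sort i) (.sort j)) : i = j := by
  obtain ⟨t, hi, hj⟩ := h.join
  exact Tm.sort.inj ((reflTransGen_par_sort hi).symm.trans (reflTransGen_par_sort hj))

theorem Conv.pi_inj {A A' B B' : Tm} (h : Conv (.pi A B) (.pi A' B')) :
    Conv A A' ∧ Conv B B' := by
  obtain ⟨t, h₁, h₂⟩ := h.join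
  obtain ⟨_, _, rfl, hA, hB⟩ := reflTransGen_par_pi h₁
  obtain ⟨_, _, heq, hA', hB'⟩ := reflTransGen_par_pi h₂
  cases heq
  exact ⟨hA.trans hA'.symm, hB.trans hB'.symm⟩

/-- Inferred types are unique up to conversion. -/
theorem InferC.unique {Γ : Ctx} {t T T' : Tm} (h : InferC Γ t T) (h' : InferC Γ t T') :
    Conv T T' := by
  induction t generalizing Γ T T' with
  | var | sort => cases h; cases h'; grind [Conv.refl]
  | pi A B ihA ihB =>
    obtain _ | _ | ⟨⟨hA, rA⟩, ⟨hB, rB⟩⟩ := h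
    obtain _ | _ | ⟨⟨hA', rA'⟩, ⟨hB', rB'⟩⟩ := h'
    obtain rfl := (rA.conv.symm.trans ((ihA hA hA').trans rA'.conv)).sort_inj
    obtain rfl := (rB.conv.symm.trans ((ihB hB hB').trans rB'.conv)).sort_inj
    exact .refl _
  | lam A t _ iht =>
    obtain _ | _ | _ | ⟨_, ht⟩ := h
    obtain _ | _ | _ | ⟨_, ht'⟩ := h'
    exact .pi (.refl A) (iht ht ht')
  | app t u iht _ =>
    obtain _ | _ | _ | _ | ⟨⟨ht, r⟩, _⟩ := h
    obtain _ | _ | _ | _ | ⟨⟨ht', r'⟩, _⟩ := h'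
    exact (r.conv.symm.trans ((iht ht ht').trans r'.conv)).pi_inj.2.subst u 0

/-- **Uniqueness of constrained-inferred types (cumulative system).** -/
theorem constrained_inferC_unique {Γ : Ctx} {t T T' : Tm} (hΓ : WfCtxC Γ)
    (h : (InferSortC Γ t T ∧ InferSortC Γ t T') ∨
         (InferPiC Γ t T ∧ InferPiC Γ t T')) : Conv T T' := by
  obtain ⟨⟨h, r⟩, ⟨h', r'⟩⟩ | ⟨⟨h, r⟩, ⟨h', r'⟩⟩ := h
  all_goals exact r.conv.symm.trans ((h.unique h').trans r'.conv)

end CComega
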